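/- arXiv:1301.4630 — 2 statements merged into one kernel-verified Lean document; each statement's English description precedes it below -/
import Mathlib

section
/- If D₁ and D₂ are finite lower sets in ℕ₀ⁿ, then their sum D₁ + D₂ (as defined by dropping a translate of D₂ along the last axis onto D₁) is a lower set, and #(D₁ + D₂) = #D₁ + #D₂. -/
def IsLowerSetN {n : ℕ} (D : Set (Fin n → ℕ)) : Prop :=
  ∀ d ∈ D, ∀ i : Fin n, d i ≠ 0 → Function.update d i (d i - 1) ∈ D

/-- the height of the column of `D` over `v`: `#{a : (v,a) ∈ D}`. -/
noncomputable def colH {n : ℕ} (D : Set (Fin (n + 1) → ℕ)) (v : Fin n → ℕ) : ℕ :=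
  Set.ncard {a : ℕ | Fin.snoc v a ∈ D}

/-- Addition of lower sets: the column over each `v` has height equal to the sum of
the heights of the columns of `D₁` and `D₂` over `v` (columns of `D₂` are stacked
on top of columns of `D₁` along the last coordinate). -/
noncomputable def lowAdd {n : ℕ} (D₁ D₂ : Set (Fin (n + 1) → ℕ)) : Set (Fin (n + 1) → ℕ) :=
  {x | x (Fin.last n) < colH D₁ (Fin.init x) + colH D₂ (Fin.init x)}

theorem colH_finite {n : ℕ} {D : Set (Fin (n + 1) → ℕ)} (hD : D.Finite) (v : Fin n → ℕ) :
    {a : ℕ | (Fin.snoc v a : Fin (n + 1) → ℕ) ∈ D}.Finite :=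
  hD.preimage fun a _ b _ h => by
    simpa using congrFun h (Fin.last n)

theorem IsLowerSetN.colH_le_update {n : ℕ} {D : Set (Fin (n + 1) → ℕ)} (hl : IsLowerSetN D)
    (hD : D.Finite) (v : Fin n → ℕ) (i : Fin n) (hi : v i ≠ 0) :
    colH D v ≤ colH D (Function.update v i (v i - 1)) := by
  refine Set.ncard_le_ncard (fun a ha => ?_) (colH_finite hD _)
  have h := hl _ ha i.castSucc (by simpa using hi)
  rw [Fin.snoc_castSucc (α := fun _ => ℕ)] at h
  rw [Set.mem_ofPred_eq, Fin.snoc_update]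
  exact h

theorem ncard_eq_sum_colH {n : ℕ} {D : Set (Fin (n + 1) → ℕ)} (hD : D.Finite)
    (S : Finset (Fin n → ℕ)) (hS : ∀ x ∈ D, (Fin.init x : Fin n → ℕ) ∈ S) :
    D.ncard = ∑ v ∈ S, colH D v := by
  classical
  rw [Set.ncard_eq_toFinset_card D hD,
    Finset.card_eq_sum_card_fiberwise (f := fun x => (Fin.init x : Fin n → ℕ)) (t := S)
      (fun x hx => hS x (by simpa using hx))]
  refine Finset.sum_congr rfl fun v _ => ?_
  have hinj : Function.Injective fun a : ℕ => (Fin.snoc v a : Fin (n + 1) → ℕ) := fun a b h => by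
    simpa using congrFun h (Fin.last n)
  rw [colH, ← Set.ncard_image_of_injective _ hinj, ← Set.ncard_coe_finset]
  congr 1
  ext x
  simp only [Finset.coe_filter, Set.Finite.mem_toFinset, Set.mem_ofPred_eq, Set.mem_image]
  constructor
  · rintro ⟨hx, rfl⟩
    exact ⟨x (Fin.last n), by simpa using hx, by simp⟩
  · rintro ⟨a, ha, rfl⟩
    exact ⟨ha, by simp⟩

theorem colH_lowAdd {n : ℕ} (D₁ D₂ : Set (Fin (n + 1) → ℕ)) (v : Fin n → ℕ) :
    colH (lowAdd D₁ D₂) v = colH D₁ v + colH D₂ v := by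
  have h : {a : ℕ | (Fin.snoc v a : Fin (n + 1) → ℕ) ∈ lowAdd D₁ D₂} =
      (Finset.range (colH D₁ v + colH D₂ v) : Set ℕ) := by
    ext a
    simp [lowAdd]
  rw [colH, h, Set.ncard_coe_finset, Finset.card_range]

theorem init_mem_image_of_colH_pos {n : ℕ} {D : Set (Fin (n + 1) → ℕ)} {v : Fin n → ℕ}
    (h : 0 < colH D v) : v ∈ (fun x => (Fin.init x : Fin n → ℕ)) '' D := by
  obtain ⟨a, ha⟩ := Set.nonempty_of_ncard_ne_zero h.ne'
  exact ⟨_, ha, by simp⟩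

theorem init_mem_of_mem_lowAdd {n : ℕ} {D₁ D₂ : Set (Fin (n + 1) → ℕ)} {x : Fin (n + 1) → ℕ}
    (hx : x ∈ lowAdd D₁ D₂) :
    (Fin.init x : Fin n → ℕ) ∈ (fun x => (Fin.init x : Fin n → ℕ)) '' (D₁ ∪ D₂) := by
  have hx' : x (Fin.last n) < colH D₁ (Fin.init x) + colH D₂ (Fin.init x) := hx
  rw [Set.image_union]
  rcases Nat.eq_zero_or_pos (colH D₁ (Fin.init x)) with h | h
  · exact Or.inr (init_mem_image_of_colH_pos (by omega))
  · exact Or.inl (init_mem_image_of_colH_pos h)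

theorem lowAdd_finite {n : ℕ} {D₁ D₂ : Set (Fin (n + 1) → ℕ)} (h₁ : D₁.Finite) (h₂ : D₂.Finite) :
    (lowAdd D₁ D₂).Finite := by
  refine (((h₁.union h₂).image fun x => (Fin.init x : Fin n → ℕ)).biUnion fun v _ =>
    (Set.finite_Iio (colH D₁ v + colH D₂ v)).image
      fun a => (Fin.snoc v a : Fin (n + 1) → ℕ)).subset fun x hx => ?_
  exact Set.mem_biUnion (init_mem_of_mem_lowAdd hx) ⟨x (Fin.last n), hx, by simp⟩

theorem IsLowerSetN.lowAdd {n : ℕ} {D₁ D₂ : Set (Fin (n + 1) → ℕ)}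
    (hl₁ : IsLowerSetN D₁) (h₁ : D₁.Finite) (h₂ : D₂.Finite) (hl₂ : IsLowerSetN D₂) :
    IsLowerSetN (_root_.lowAdd D₁ D₂) := by
  intro x hx i hi
  have hx' : x (Fin.last n) < colH D₁ (Fin.init x) + colH D₂ (Fin.init x) := hx
  change Function.update x i (x i - 1) (Fin.last n) <
    colH D₁ (Fin.init (Function.update x i (x i - 1))) +
      colH D₂ (Fin.init (Function.update x i (x i - 1)))
  induction i using Fin.lastCases with
  | last =>
    rw [Fin.init_update_last, Function.update_self]
    omega
  | cast i =>
    rw [Fin.init_update_castSucc, Function.update_of_ne (Fin.castSucc_lt_last i).ne']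
    have k₁ := hl₁.colH_le_update h₁ (Fin.init x) i hi
    have k₂ := hl₂.colH_le_update h₂ (Fin.init x) i hi
    exact hx'.trans_le (add_le_add k₁ k₂)

/-- The sum of two finite lower sets is a lower set of cardinality the sum of
the cardinalities. -/
theorem lowAdd_isLowerSet_and_card {n : ℕ} (D₁ D₂ : Set (Fin (n + 1) → ℕ))
    (h₁ : D₁.Finite) (h₂ : D₂.Finite) (hl₁ : IsLowerSetN D₁) (hl₂ : IsLowerSetN D₂) :
    IsLowerSetN (lowAdd D₁ D₂) ∧ (lowAdd D₁ D₂).ncard = D₁.ncard + D₂.ncard := by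
  refine ⟨hl₁.lowAdd h₁ h₂ hl₂, ?_⟩
  let S := ((h₁.union h₂).image fun x => (Fin.init x : Fin n → ℕ)).toFinset
  rw [ncard_eq_sum_colH (lowAdd_finite h₁ h₂) S
      fun x hx => (Set.Finite.mem_toFinset _).2 (init_mem_of_mem_lowAdd hx),
    ncard_eq_sum_colH h₁ S
      fun x hx => (Set.Finite.mem_toFinset _).2 ⟨x, Or.inl hx, rfl⟩,
    ncard_eq_sum_colH h₂ S
      fun x hx => (Set.Finite.mem_toFinset _).2 ⟨x, Or.inr hx, rfl⟩,
    ← Finset.sum_add_distrib]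
  exact Finset.sum_congr rfl fun v _ => colH_lowAdd D₁ D₂ v
end

section
/- Let H be the set of three points in k² with multiplicity structures: p₁=(1,1) with D₁={(0,0),(0,1),(1,0)}, p₂=(2,1) with D₂={(0,0),(0,1),(1,0),(1,1)}, p₃=(0,2) with D₃={(0,0),(1,0)}. Then the set {1, X₁, X₂, X₁X₂, X₁², X₁²X₂, X₁³, X₂², X₁X₂², X₂³ ... } given by the lower set D = {(0,0),(1,0),(2,0),(3,0),(0,1),(1,1),(2,1),(0,2),(1,2)} is a k-basis of k[X₁,X₂]/I(H), where I(H) is the ideal of polynomials annihilated by the 9 derivative functionals of H. -/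
noncomputable def mderiv {n : ℕ} {k : Type*} [CommSemiring k]
    (d : Fin n → ℕ) (f : MvPolynomial (Fin n) k) : MvPolynomial (Fin n) k :=
  (List.finRange n).foldr (fun i g => (fun h => MvPolynomial.pderiv i h)^[d i] g) f

open MvPolynomial

theorem mderiv_add {n : ℕ} {k : Type*} [CommSemiring k] (d : Fin n → ℕ)
    (f g : MvPolynomial (Fin n) k) : mderiv d (f + g) = mderiv d f + mderiv d g := by
  unfold mderiv
  induction List.finRange n with
  | nil => rfl
  | cons i l ih => simp only [List.foldr_cons, ih, iterate_map_add]

theorem mderiv_smul {n : ℕ} {k : Type*} [CommSemiring k] (d : Fin n → ℕ)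
    (c : k) (f : MvPolynomial (Fin n) k) : mderiv d (c • f) = c • mderiv d f := by
  unfold mderiv
  induction List.finRange n with
  | nil => rfl
  | cons i l ih =>
    simp only [List.foldr_cons, ih]
    exact Function.Commute.iterate_left (g := (c • ·)) (fun f => (pderiv i).map_smul c f) _ _

theorem mderiv_fin_two {k : Type*} [CommSemiring k] (a b : ℕ) (f : MvPolynomial (Fin 2) k) :
    mderiv ![a, b] f = (pderiv 0)^[a] ((pderiv 1)^[b] f) := by
  simp [mderiv, List.finRange_succ]

/-- The functional `f ↦ (∂^d f)(p)`. -/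
noncomputable def mderivEval {n : ℕ} {k : Type*} [CommSemiring k] (p : Fin n → k)
    (d : Fin n → ℕ) : MvPolynomial (Fin n) k →ₗ[k] k where
  toFun f := eval p (mderiv d f)
  map_add' f g := by rw [mderiv_add, map_add]
  map_smul' c f := by rw [mderiv_smul, smul_eval, RingHom.id_apply, smul_eq_mul]

/-- If the kernel of `q` is cut out by finitely many functionals `L`, and the values of as many
vectors under these functionals are linearly independent, then the images of these
vectors form a basis. -/
theorem linearIndependent_and_span_eq_top_of_ker {ι k M N : Type*} [Fintype ι] [Field k]
    [AddCommGroup M] [Module k M] [AddCommGroup N] [Module k N]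
    (L : M →ₗ[k] ι → k) (q : M →ₗ[k] N) (hq : Function.Surjective q)
    (hker : LinearMap.ker q = LinearMap.ker L) (b : ι → M)
    (hb : LinearIndependent k (L ∘ b)) :
    LinearIndependent k (q ∘ b) ∧ Submodule.span k (Set.range (q ∘ b)) = ⊤ := by
  constructor
  · rw [Fintype.linearIndependent_iff] at hb ⊢
    intro c hc
    refine hb c ?_
    simp only [Function.comp_apply, ← map_smul, ← map_sum] at hc ⊢
    rwa [← LinearMap.mem_ker, ← hker]
  · have hspan := hb.span_eq_top_of_card_eq_finrank' (by simp)
    rw [Set.range_comp, Submodule.span_image] at hspan ⊢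
    have hsup : Submodule.span k (Set.range b) ⊔ LinearMap.ker L = ⊤ := by
      rw [← Submodule.comap_map_eq, hspan, Submodule.comap_top]
    rw [← hker, ← Submodule.comap_map_eq] at hsup
    rw [← Submodule.map_comap_eq_of_surjective hq (Submodule.map q _), hsup, Submodule.map_top,
      LinearMap.range_eq_top.2 hq]

/-- The exponents of the monomial basis. -/
def basisExponent : Fin 9 → Fin 2 → ℕ :=
  ![![0,0], ![1,0], ![2,0], ![3,0], ![0,1], ![1,1], ![2,1], ![0,2], ![1,2]]

/-- The nine functionals attached to the configuration. -/
noncomputable def configurationEval (k : Type*) [Field k] :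
    MvPolynomial (Fin 2) k →ₗ[k] Fin 9 → k :=
  LinearMap.pi ![mderivEval ![1,1] ![0,0], mderivEval ![1,1] ![0,1], mderivEval ![1,1] ![1,0],
    mderivEval ![2,1] ![0,0], mderivEval ![2,1] ![0,1], mderivEval ![2,1] ![1,0],
    mderivEval ![2,1] ![1,1], mderivEval ![0,2] ![0,0], mderivEval ![0,2] ![1,0]]

theorem monomial_one_fin_two {k : Type*} [CommSemiring k] (a b : ℕ) :
    monomial (Finsupp.equivFunOnFinite.symm ![a, b]) (1 : k) = X 0 ^ a * X 1 ^ b := by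
  rw [monomial_eq]
  simp [Finsupp.prod_fintype]

theorem linearIndependent_configurationEval (k : Type*) [Field k] :
    LinearIndependent k (configurationEval k ∘ fun i =>
      monomial (Finsupp.equivFunOnFinite.symm (basisExponent i)) (1 : k)) := by
  rw [Fintype.linearIndependent_iff]
  intro c hc
  have h := fun i => congrFun hc i
  simp only [Fin.forall_fin_succ, Fin.sum_univ_succ] at h
  have hX : pderiv 0 (2 : MvPolynomial (Fin 2) k) = 0 := Derivation.map_natCast _ 2
  simp [configurationEval, basisExponent, monomial_one_fin_two, mderivEval, mderiv_fin_two,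
    hX] at h
  obtain ⟨h0, h1, h2, h3, h4, h5, h6, h7, h8⟩ := h
  simp only [Fin.forall_fin_succ, IsEmpty.forall_iff, and_true, Fin.succ_zero_eq_one,
    Fin.reduceSucc]
  refine ⟨?_, ?_, ?_, ?_, ?_, ?_, ?_, ?_, ?_⟩
  · linear_combination -8 * h1 + 6 * h4 - 4 * h6 + h7
  · linear_combination 8 * h1 - 8 * h4 + 6 * h6 + h8
  · linear_combination -9 * h0 - h1 - 5 * h2 + 9 * h3 + h4 - 4 * h5 - h6
  · linear_combination 2 * h0 + h2 - 2 * h3 + h5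
  · linear_combination -8 * h0 + 12 * h1 - 8 * h2 + 10 * h3 - 9 * h4 - 4 * h5 + 6 * h6 - 2 * h7
  · linear_combination 24 * h0 - 12 * h1 + 16 * h2 - 24 * h3 + 12 * h4 + 10 * h5 - 9 * h6 - 2 * h8
  · linear_combination h1 - h4 + h6
  · linear_combination 4 * h0 - 4 * h1 + 4 * h2 - 5 * h3 + 3 * h4 + 2 * h5 - 2 * h6 + h7
  · linear_combination -12 * h0 + 4 * h1 - 8 * h2 + 12 * h3 - 4 * h4 - 5 * h5 + 3 * h6 + h8

theorem bijective_basisExponent : Function.Bijective (fun i : Fin 9 =>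
    (⟨basisExponent i, by revert i; decide⟩ :
      ({![0,0], ![1,0], ![2,0], ![3,0], ![0,1], ![1,1], ![2,1], ![0,2], ![1,2]}
          : Finset (Fin 2 → ℕ)))) := by
  decide

/-- For the configuration `H` of the paper's running example
(`p₁=(1,1)` with `D₁={(0,0),(0,1),(1,0)}`, `p₂=(2,1)` with
`D₂={(0,0),(0,1),(1,0),(1,1)}`, `p₃=(0,2)` with `D₃={(0,0),(1,0)}`),
the monomials of the lower set
`D = {(0,0),(1,0),(2,0),(3,0),(0,1),(1,1),(2,1),(0,2),(1,2)}`
form a `k`-basis of `k[X₁,X₂]/I(H)`. -/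
theorem example_quotient_basis {k : Type*} [Field k] [CharZero k]
    (I : Ideal (MvPolynomial (Fin 2) k))
    (hI : (I : Set (MvPolynomial (Fin 2) k)) =
      {f | ∀ j : Fin 3,
        ∀ d ∈ (![({![0,0], ![0,1], ![1,0]} : Finset (Fin 2 → ℕ)),
                 ({![0,0], ![0,1], ![1,0], ![1,1]} : Finset (Fin 2 → ℕ)),
                 ({![0,0], ![1,0]} : Finset (Fin 2 → ℕ))] j),
          eval (![(![1,1] : Fin 2 → k), ![2,1], ![0,2]] j) (mderiv d f) = 0}) :
    LinearIndependent k (fun d :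
        ({![0,0], ![1,0], ![2,0], ![3,0], ![0,1], ![1,1], ![2,1], ![0,2], ![1,2]}
          : Finset (Fin 2 → ℕ)) =>
      Ideal.Quotient.mk I (monomial (Finsupp.equivFunOnFinite.symm ↑d) (1 : k))) ∧
    Submodule.span k (Set.range (fun d :
        ({![0,0], ![1,0], ![2,0], ![3,0], ![0,1], ![1,1], ![2,1], ![0,2], ![1,2]}
          : Finset (Fin 2 → ℕ)) =>
      Ideal.Quotient.mk I (monomial (Finsupp.equivFunOnFinite.symm ↑d) (1 : k)))) = ⊤ := by
  let e := Equiv.ofBijective _ bijective_basisExponent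
  have hker : LinearMap.ker (Ideal.Quotient.mkₐ k I).toLinearMap =
      LinearMap.ker (configurationEval k) := by
    ext f
    have hf := Set.ext_iff.1 hI f
    simp only [SetLike.mem_coe, Set.mem_ofPred_eq, Fin.forall_fin_succ, Matrix.cons_val_zero,
      Matrix.cons_val_succ, Finset.forall_mem_insert, Finset.mem_singleton, forall_eq] at hf
    simp [Ideal.Quotient.eq_zero_iff_mem, hf, Fin.forall_fin_succ, configurationEval,
      mderivEval, _root_.funext_iff, and_assoc]
  have h := linearIndependent_and_span_eq_top_of_ker (configurationEval k)
    (Ideal.Quotient.mkₐ k I).toLinearMap (Ideal.Quotient.mkₐ_surjective k I) hker _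
    (linearIndependent_configurationEval k)
  rw [← linearIndependent_equiv e, ← e.surjective.range_comp]
  exact h
end
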